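/- Let n ≥ 2 and let Φ be an N-function with index s(Φ) ≥ 1. For every d₀ ∈ [1, n/(n−1)) there exist θ ∈ (0,1) and c > 0, both depending only on n, s(Φ) and d₀, such that for every ball B_R ⊂ ℝⁿ of radius R > 0 and every Lipschitz function v : ℝⁿ → ℝ one has ( ⨍_{B_R} Φ( |v(x) − (v)_{B_R}| / R )^{d₀} dx )^{1/d₀} ≤ c·( ⨍_{B_R} Φ( |Dv(x)| )^{θ} dx )^{1/θ}, where Dv denotes the gradient of v (defined almost everywhere by Rademacher's theorem), (v)_{B_R} := ⨍_{B_R} v dx is the mean value of v over B_R, and ⨍ denotes the average integral. -/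

import Mathlib

open Real Set Filter MeasureTheory
open scoped RealInnerProductSpace

/-- An N-function with index `s ≥ 1`: a function `Φ : [0,∞) → [0,∞)` with `Φ(0) = 0`,
strictly increasing and convex, `Φ(t)/t → 0` as `t → 0⁺`, `Φ(t)/t → ∞` as `t → ∞`,
continuously differentiable on `[0,∞)`, twice continuously differentiable on `(0,∞)`,
and `Φ'(t) > 0` with `(1/s)·Φ'(t) ≤ t·Φ''(t) ≤ s·Φ'(t)` for every `t > 0`. -/
structure IsNFunction (Φ : ℝ → ℝ) (s : ℝ) : Prop where
  s_ge_one : 1 ≤ s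
  nonneg : ∀ t, 0 ≤ t → 0 ≤ Φ t
  zero : Φ 0 = 0
  strictMonoOn : StrictMonoOn Φ (Ici 0)
  convexOn : ConvexOn ℝ (Ici 0) Φ
  tendsto_zero : Tendsto (fun t => Φ t / t) (nhdsWithin 0 (Ioi 0)) (nhds 0)
  tendsto_atTop : Tendsto (fun t => Φ t / t) atTop atTop
  contDiffOn_one : ContDiffOn ℝ 1 Φ (Ici 0)
  contDiffOn_two : ContDiffOn ℝ 2 Φ (Ioi 0)
  deriv_pos : ∀ t, 0 < t → 0 < deriv Φ t
  index_lower : ∀ t, 0 < t → (1 / s) * deriv Φ t ≤ t * deriv (deriv Φ) t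
  index_upper : ∀ t, 0 < t → t * deriv (deriv Φ) t ≤ s * deriv Φ t


namespace OSP

lemma NF.diff {Φ : ℝ → ℝ} {s : ℝ} (h : IsNFunction Φ s) {t : ℝ} (ht : 0 < t) :
    HasDerivAt Φ (deriv Φ t) t :=
  ((h.contDiffOn_two.differentiableOn (by norm_num)).differentiableAt
    (Ioi_mem_nhds ht)).hasDerivAt

lemma NF.diff2 {Φ : ℝ → ℝ} {s : ℝ} (h : IsNFunction Φ s) {t : ℝ} (ht : 0 < t) :
    HasDerivAt (deriv Φ) (deriv (deriv Φ) t) t := by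
  have h1 : ContDiffOn ℝ 1 (deriv Φ) (Ioi 0) :=
    h.contDiffOn_two.deriv_of_isOpen isOpen_Ioi (by norm_num)
  exact ((h1.differentiableOn (by norm_num)).differentiableAt (Ioi_mem_nhds ht)).hasDerivAt

lemma NF.tendsto0 {Φ : ℝ → ℝ} {s : ℝ} (h : IsNFunction Φ s) (a : ℝ) (ha : 0 < a) :
    Tendsto (fun t => Φ (a * t)) (nhdsWithin 0 (Ioi 0)) (nhds 0) := by
  have h1 : ContinuousWithinAt Φ (Ici 0) 0 := h.contDiffOn_one.continuousOn 0 (by simp)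
  have h2 : Tendsto Φ (nhdsWithin 0 (Ici 0)) (nhds 0) := by
    simpa [ContinuousWithinAt, h.zero] using h1
  refine h2.comp ?_
  refine tendsto_nhdsWithin_iff.2 ⟨?_, ?_⟩
  · have : Continuous fun t : ℝ => a * t := by fun_prop
    have := this.tendsto 0
    simp only [mul_zero] at this
    exact this.mono_left nhdsWithin_le_nhds
  · filter_upwards [self_mem_nhdsWithin] with t ht
    exact (mul_pos ha ht).le

lemma NF.lower {Φ : ℝ → ℝ} {s : ℝ} (h : IsNFunction Φ s) {t : ℝ} (ht : 0 < t) :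
    (1 + 1 / s) * Φ t ≤ t * deriv Φ t := by
  have hs := h.s_ge_one
  have hmono : MonotoneOn (fun t => t * deriv Φ t - (1 + 1 / s) * Φ t) (Ioi 0) := by
    have hd : ∀ x ∈ Ioi (0:ℝ), HasDerivAt (fun t => t * deriv Φ t - (1 + 1 / s) * Φ t)
        (1 * deriv Φ x + x * deriv (deriv Φ) x - (1 + 1 / s) * deriv Φ x) x := fun x hx =>
      ((hasDerivAt_id x).mul (NF.diff2 h hx)).sub ((NF.diff h hx).const_mul _)
    refine monotoneOn_of_deriv_nonneg (convex_Ioi 0)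
      (fun x hx => (hd x hx).continuousAt.continuousWithinAt)
      (fun x hx => (hd x (by simpa using hx)).differentiableAt.differentiableWithinAt) ?_
    intro x hx
    rw [interior_Ioi] at hx
    rw [(hd x hx).deriv]
    have := h.index_lower x hx
    linarith
  have h0 : Tendsto (fun e => -((1 + 1 / s) * Φ (1 * e))) (nhdsWithin 0 (Ioi 0)) (nhds 0) := by
    have := ((NF.tendsto0 h 1 one_pos).const_mul (1 + 1 / s)).neg
    simpa using this
  have : 0 ≤ t * deriv Φ t - (1 + 1 / s) * Φ t := by
    refine le_of_tendsto h0 ?_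
    filter_upwards [Ioo_mem_nhdsGT ht] with e he
    have h1 := hmono he.1 ht he.2.le
    simp only at h1
    have h2 := mul_pos he.1 (h.deriv_pos e he.1)
    rw [one_mul]
    linarith
  linarith

lemma NF.upper {Φ : ℝ → ℝ} {s : ℝ} (h : IsNFunction Φ s) {t : ℝ} (ht : 0 < t) :
    t * deriv Φ t ≤ (1 + s) * Φ t := by
  have hs := h.s_ge_one
  have hmono : MonotoneOn (fun t => (1 + s) * Φ t - t * deriv Φ t) (Ioi 0) := by
    have hd : ∀ x ∈ Ioi (0:ℝ), HasDerivAt (fun t => (1 + s) * Φ t - t * deriv Φ t)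
        ((1 + s) * deriv Φ x - (1 * deriv Φ x + x * deriv (deriv Φ) x)) x := fun x hx =>
      ((NF.diff h hx).const_mul _).sub ((hasDerivAt_id x).mul (NF.diff2 h hx))
    refine monotoneOn_of_deriv_nonneg (convex_Ioi 0)
      (fun x hx => (hd x hx).continuousAt.continuousWithinAt)
      (fun x hx => (hd x (by simpa using hx)).differentiableAt.differentiableWithinAt) ?_
    intro x hx
    rw [interior_Ioi] at hx
    rw [(hd x hx).deriv]
    have := h.index_upper x hx
    linarith
  have h0 : Tendsto (fun e => -(Φ (2 * e))) (nhdsWithin 0 (Ioi 0)) (nhds 0) := by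
    have := (NF.tendsto0 h 2 two_pos).neg
    simpa using this
  have : 0 ≤ (1 + s) * Φ t - t * deriv Φ t := by
    refine le_of_tendsto h0 ?_
    filter_upwards [Ioo_mem_nhdsGT ht] with e he
    have he0 : 0 < e := he.1
    have h1 := hmono he.1 ht he.2.le
    simp only at h1
    have h2 : deriv Φ e ≤ (Φ (2 * e) - Φ e) / (2 * e - e) := by
      have := h.convexOn.le_slope_of_hasDerivAt (x := e) (y := 2 * e) he0.le
        (by simp; linarith) (by linarith) (NF.diff h he0)
      rwa [slope_def_field] at this
    rw [le_div_iff₀ (by linarith)] at h2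
    have h3 := h.nonneg e he0.le
    have h4 : 0 ≤ (1 + s) * Φ e := by positivity
    nlinarith
  linarith

lemma NF.pos {Φ : ℝ → ℝ} {s : ℝ} (h : IsNFunction Φ s) {t : ℝ} (ht : 0 < t) : 0 < Φ t := by
  have := h.strictMonoOn (a := 0) (b := t) (by simp) ht.le ht
  rwa [h.zero] at this

/-- lower scaling -/
lemma NF.scale_low {Φ : ℝ → ℝ} {s : ℝ} (h : IsNFunction Φ s) {a b : ℝ} (ha : 0 < a) (hab : a ≤ b) :
    Φ a * (b / a) ^ (1 + 1 / s) ≤ Φ b := by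
  have hd : ∀ x ∈ Ioi (0:ℝ), HasDerivAt (fun t => Real.log (Φ t) - (1 + 1 / s) * Real.log t)
      (deriv Φ x / Φ x - (1 + 1 / s) * x⁻¹) x := fun x hx =>
    ((NF.diff h hx).log (NF.pos h hx).ne').sub ((Real.hasDerivAt_log (ne_of_gt hx)).const_mul _)
  have hmono : MonotoneOn (fun t => Real.log (Φ t) - (1 + 1 / s) * Real.log t) (Ioi 0) := by
    refine monotoneOn_of_deriv_nonneg (convex_Ioi 0)
      (fun x hx => (hd x hx).continuousAt.continuousWithinAt)
      (fun x hx => (hd x (by simpa using hx)).differentiableAt.differentiableWithinAt) ?_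
    intro x hx
    rw [interior_Ioi] at hx
    have hx0 : 0 < x := hx
    rw [(hd x hx).deriv, sub_nonneg, ← div_eq_mul_inv, div_le_div_iff₀ hx (NF.pos h hx)]
    have := NF.lower h hx0
    linarith
  have hb : 0 < b := ha.trans_le hab
  have h1 := hmono ha hb hab
  simp only at h1
  have hpa := NF.pos h ha
  have hpb := NF.pos h hb
  have hr : 0 < (b / a) ^ (1 + 1 / s) := Real.rpow_pos_of_pos (by positivity) _
  rw [← Real.log_le_log_iff (by positivity) hpb, Real.log_mul hpa.ne' hr.ne',
    Real.log_rpow (by positivity), Real.log_div hb.ne' ha.ne']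
  linarith

/-- upper scaling -/
lemma NF.scale_up {Φ : ℝ → ℝ} {s : ℝ} (h : IsNFunction Φ s) {a b : ℝ} (ha : 0 < a) (hab : a ≤ b) :
    Φ b ≤ Φ a * (b / a) ^ (1 + s) := by
  have hd : ∀ x ∈ Ioi (0:ℝ), HasDerivAt (fun t => (1 + s) * Real.log t - Real.log (Φ t))
      ((1 + s) * x⁻¹ - deriv Φ x / Φ x) x := fun x hx =>
    ((Real.hasDerivAt_log (ne_of_gt hx)).const_mul _).sub ((NF.diff h hx).log (NF.pos h hx).ne')
  have hmono : MonotoneOn (fun t => (1 + s) * Real.log t - Real.log (Φ t)) (Ioi 0) := by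
    refine monotoneOn_of_deriv_nonneg (convex_Ioi 0)
      (fun x hx => (hd x hx).continuousAt.continuousWithinAt)
      (fun x hx => (hd x (by simpa using hx)).differentiableAt.differentiableWithinAt) ?_
    intro x hx
    rw [interior_Ioi] at hx
    have hx0 : 0 < x := hx
    rw [(hd x hx).deriv, sub_nonneg, ← div_eq_mul_inv, div_le_div_iff₀ (NF.pos h hx) hx]
    have := NF.upper h hx0
    linarith
  have hb : 0 < b := ha.trans_le hab
  have h1 := hmono ha hb hab
  simp only at h1
  have hpa := NF.pos h ha
  have hpb := NF.pos h hb
  have hr : 0 < (b / a) ^ (1 + s) := Real.rpow_pos_of_pos (by positivity) _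
  rw [← Real.log_le_log_iff hpb (by positivity), Real.log_mul hpa.ne' hr.ne',
    Real.log_rpow (by positivity), Real.log_div hb.ne' ha.ne']
  linarith

lemma NF.psi_mono {Φ : ℝ → ℝ} {s θ : ℝ} (h : IsNFunction Φ s) (hθ : s / (s + 1) ≤ θ)
    {a b : ℝ} (ha : 0 < a) (hab : a ≤ b) :
    Φ a ^ θ * (b / a) ≤ Φ b ^ θ := by
  have hs := h.s_ge_one
  have hθ0 : 0 < θ := lt_of_lt_of_le (by positivity) hθ
  have h1 := NF.scale_low h ha hab
  have hba : 1 ≤ b / a := (one_le_div ha).2 hab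
  calc Φ a ^ θ * (b / a) = Φ a ^ θ * (b / a) ^ (1:ℝ) := by rw [Real.rpow_one]
    _ ≤ Φ a ^ θ * (b / a) ^ ((1 + 1 / s) * θ) := by
      have := (NF.pos h ha).le
      gcongr ?_ * ?_
      apply Real.rpow_le_rpow_of_exponent_le hba
      calc (1:ℝ) = (1 + 1 / s) * (s / (s + 1)) := by field_simp; 
        _ ≤ _ := by gcongr
    _ = (Φ a * (b / a) ^ (1 + 1 / s)) ^ θ := by
      rw [Real.mul_rpow (NF.pos h ha).le (by positivity), ← Real.rpow_mul (by positivity)]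
    _ ≤ _ := by
      have := (NF.pos h ha).le
      gcongr

lemma NF.psi_double {Φ : ℝ → ℝ} {s θ : ℝ} (h : IsNFunction Φ s) (hθ : 0 < θ) (hθ1 : θ < 1)
    {l : ℝ} (hl : 1 ≤ l) {a : ℝ} (ha : 0 ≤ a) :
    Φ (l * a) ^ θ ≤ l ^ (1 + s) * Φ a ^ θ := by
  have hs := h.s_ge_one
  rcases ha.eq_or_lt with rfl | ha
  · simp [h.zero, Real.zero_rpow hθ.ne']
  have h1 := NF.scale_up h ha (le_mul_of_one_le_left ha.le hl)
  rw [mul_div_cancel_right₀ _ ha.ne'] at h1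
  have hp := (NF.pos h ha).le
  have hl0 : 0 ≤ l := by linarith
  calc Φ (l * a) ^ θ ≤ (Φ a * l ^ (1 + s)) ^ θ := by
        have := h.nonneg (l * a) (by positivity)
        gcongr
    _ = Φ a ^ θ * (l ^ (1 + s)) ^ θ := Real.mul_rpow hp (by positivity)
    _ ≤ Φ a ^ θ * (l ^ (1 + s)) ^ (1:ℝ) := by
        gcongr
        exact Real.one_le_rpow hl (by linarith)
    _ = _ := by rw [Real.rpow_one, mul_comm]

/-- quasi-Jensen inequality -/
lemma NF.jensen {Φ : ℝ → ℝ} {s θ : ℝ} (h : IsNFunction Φ s) (hθ : s / (s + 1) ≤ θ)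
    {α : Type*} [MeasurableSpace α] (ν : Measure α) {M : ℝ} (hM : 0 < M)
    (hν : ν univ ≤ ENNReal.ofReal M) (f : α → ℝ) (hf : ∀ x, 0 ≤ f x) 
    {m : ℝ} (hm : 0 ≤ m) (hmf : ENNReal.ofReal m ≤ ∫⁻ x, ENNReal.ofReal (f x) ∂ν) :
    ENNReal.ofReal (M * Φ (m / (2 * M)) ^ θ) ≤ ∫⁻ x, ENNReal.ofReal (Φ (f x) ^ θ) ∂ν := by
  have hs := h.s_ge_one
  have hθ0 : 0 < θ := lt_of_lt_of_le (by positivity) hθ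
  rcases hm.eq_or_lt with rfl | hm
  · simp [h.zero, Real.zero_rpow hθ0.ne']
  set τ := m / (2 * M) with hτ
  have hτ0 : 0 < τ := by positivity
  have hψ : 0 < Φ τ ^ θ := Real.rpow_pos_of_pos (NF.pos h hτ0) _
  have hpt : ∀ x, ENNReal.ofReal (f x) ≤ ENNReal.ofReal τ +
      ENNReal.ofReal (τ / Φ τ ^ θ) * ENNReal.ofReal (Φ (f x) ^ θ) := by
    intro x
    have hn : 0 ≤ Φ (f x) ^ θ := Real.rpow_nonneg (h.nonneg _ (hf x)) _
    rw [← ENNReal.ofReal_mul (by positivity), ← ENNReal.ofReal_add hτ0.le (by positivity)]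
    apply ENNReal.ofReal_le_ofReal
    rcases le_total (f x) τ with hle | hle
    · have : 0 ≤ τ / Φ τ ^ θ * Φ (f x) ^ θ := by positivity
      linarith
    · have := NF.psi_mono h hθ hτ0 hle
      have h2 : f x ≤ τ / Φ τ ^ θ * Φ (f x) ^ θ := by
        rw [div_mul_eq_mul_div, le_div_iff₀ hψ]
        calc f x * Φ τ ^ θ = τ * (Φ τ ^ θ * (f x / τ)) := by field_simp
          _ ≤ _ := by gcongr
      linarith
  have h1 : ENNReal.ofReal m ≤ ENNReal.ofReal (m / 2) + ENNReal.ofReal (τ / Φ τ ^ θ) *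
      ∫⁻ x, ENNReal.ofReal (Φ (f x) ^ θ) ∂ν := by
    calc ENNReal.ofReal m ≤ _ := hmf
      _ ≤ ∫⁻ x, (ENNReal.ofReal τ +
        ENNReal.ofReal (τ / Φ τ ^ θ) * ENNReal.ofReal (Φ (f x) ^ θ)) ∂ν := lintegral_mono hpt
      _ = ENNReal.ofReal τ * ν univ + ENNReal.ofReal (τ / Φ τ ^ θ) *
          ∫⁻ x, ENNReal.ofReal (Φ (f x) ^ θ) ∂ν := by
        rw [lintegral_add_left measurable_const, lintegral_const,
          lintegral_const_mul' _ _ ENNReal.ofReal_ne_top]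
      _ ≤ ENNReal.ofReal τ * ENNReal.ofReal M + _ := by gcongr
      _ = _ := by
        rw [← ENNReal.ofReal_mul hτ0.le]
        congr 2
        rw [hτ]; field_simp
  have h2 : ENNReal.ofReal (m / 2) ≤ ENNReal.ofReal (τ / Φ τ ^ θ) *
      ∫⁻ x, ENNReal.ofReal (Φ (f x) ^ θ) ∂ν := by
    have : ENNReal.ofReal m = ENNReal.ofReal (m / 2) + ENNReal.ofReal (m / 2) := by
      rw [← ENNReal.ofReal_add (by positivity) (by positivity)]; congr 1; ring
    rw [this] at h1
    exact (ENNReal.add_le_add_iff_left ENNReal.ofReal_ne_top).1 h1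
  calc ENNReal.ofReal (M * Φ τ ^ θ) = ENNReal.ofReal (Φ τ ^ θ / τ) * ENNReal.ofReal (m / 2) := by
        rw [← ENNReal.ofReal_mul (by positivity)]
        congr 1
        rw [hτ]; field_simp
    _ ≤ ENNReal.ofReal (Φ τ ^ θ / τ) * (ENNReal.ofReal (τ / Φ τ ^ θ) *
      ∫⁻ x, ENNReal.ofReal (Φ (f x) ^ θ) ∂ν) := by gcongr
    _ = _ := by
      rw [← mul_assoc, ← ENNReal.ofReal_mul (by positivity)]
      have : Φ τ ^ θ / τ * (τ / Φ τ ^ θ) = 1 := by field_simp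
      rw [this]; simp


lemma lintegral_cv {n : ℕ} (x : EuclideanSpace ℝ (Fin n)) {t : ℝ} (ht : 0 < t)
    (F : EuclideanSpace ℝ (Fin n) → ENNReal) (hF : Measurable F) :
    ∫⁻ y, F (x + t • (y - x)) = ENNReal.ofReal ((t ^ n)⁻¹) * ∫⁻ z, F z := by
  rw [lintegral_sub_right_eq_self (fun w => F (x + t • w)) x]
  have h1 : ∫⁻ w, F (x + t • w) = ∫⁻ w, F (x + w) ∂(Measure.map (t • ·) volume) := by
    rw [lintegral_map (by fun_prop) (by fun_prop)]
  rw [h1, Measure.map_addHaar_smul volume ht.ne', lintegral_smul_measure,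
    lintegral_add_left_eq_self (fun w => F w) x]
  simp [abs_of_pos ht]

lemma kernel_bound (n : ℕ) (hn : 2 ≤ n) (a : ℝ) (ha : a < n) :
    ∃ C : ℝ, 0 < C ∧ ∀ (y : EuclideanSpace ℝ (Fin n)) (r : ℝ), 0 < r →
      ∫⁻ x in Metric.ball y r, ENNReal.ofReal (‖x - y‖ ^ (-a)) ≤
        ENNReal.ofReal (C * r ^ ((n:ℝ) - a)) := by
  have hint : IntegrableOn (fun x : EuclideanSpace ℝ (Fin n) => ‖x‖ ^ (-a))
      (Metric.ball 0 1) := by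
    refine integrableOn_ball_of_norm_le_rpow (by simp; omega) (C := 1) (α := a)
      (by simpa using ha) ?_ (measurable_norm.pow_const _).aestronglyMeasurable
    refine Eventually.of_forall fun x => ?_
    rw [Real.norm_of_nonneg (by positivity), one_mul]
  have hfin : ∫⁻ x : EuclideanSpace ℝ (Fin n) in Metric.ball 0 1, ENNReal.ofReal (‖x‖ ^ (-a))
      < ⊤ := by
    have := hint.lintegral_lt_top
    exact this
  set I := ∫⁻ x : EuclideanSpace ℝ (Fin n) in Metric.ball 0 1, ENNReal.ofReal (‖x‖ ^ (-a)) with hI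
  refine ⟨I.toReal + 1, by positivity, fun y r hr => ?_⟩
  have hI1 : I ≤ ENNReal.ofReal (I.toReal + 1) := by
    rw [ENNReal.le_ofReal_iff_toReal_le hfin.ne (by positivity)]
    linarith
  let F : EuclideanSpace ℝ (Fin n) → ENNReal :=
    (Metric.ball y r).indicator fun x => ENNReal.ofReal (‖x - y‖ ^ (-a))
  have hF : Measurable F := Measurable.indicator (by fun_prop) measurableSet_ball
  have h1 := lintegral_cv y hr F hF
  have h2 : ∀ w, F (y + r • (w - y)) = ENNReal.ofReal (r ^ (-a)) *
      (Metric.ball (0 : EuclideanSpace ℝ (Fin n)) 1).indicator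
        (fun x => ENNReal.ofReal (‖x‖ ^ (-a))) (w - y) := by
    intro w
    simp only [F, indicator, Metric.mem_ball, dist_eq_norm, add_sub_cancel_left, norm_smul,
      Real.norm_of_nonneg hr.le, sub_zero]
    have : r * ‖w - y‖ < r ↔ ‖w - y‖ < 1 := by
      constructor <;> intro h <;> nlinarith
    simp only [this]
    split_ifs
    · rw [← ENNReal.ofReal_mul (by positivity), Real.mul_rpow hr.le (norm_nonneg _)]
    · simp
  simp_rw [h2] at h1
  rw [lintegral_const_mul' _ _ ENNReal.ofReal_ne_top,
    lintegral_sub_right_eq_self (fun w => (Metric.ball (0 : EuclideanSpace ℝ (Fin n)) 1).indicator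
        (fun x => ENNReal.ofReal (‖x‖ ^ (-a))) w) y, lintegral_indicator measurableSet_ball,
    ← hI] at h1
  have h3 : ∫⁻ x in Metric.ball y r, ENNReal.ofReal (‖x - y‖ ^ (-a)) = ∫⁻ z, F z := by
    rw [lintegral_indicator measurableSet_ball]
  rw [h3]
  have h4 : ∫⁻ z, F z = ENNReal.ofReal (r ^ n) * (ENNReal.ofReal (r ^ (-a)) * I) := by
    rw [h1, ← mul_assoc, ← ENNReal.ofReal_mul (by positivity)]
    rw [mul_inv_cancel₀ (by positivity)]; simp
  rw [h4]
  calc ENNReal.ofReal (r ^ n) * (ENNReal.ofReal (r ^ (-a)) * I)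
      ≤ ENNReal.ofReal (r ^ n) * (ENNReal.ofReal (r ^ (-a)) * ENNReal.ofReal (I.toReal + 1)) := by
        gcongr
    _ = _ := by
      rw [← ENNReal.ofReal_mul (by positivity), ← ENNReal.ofReal_mul (by positivity)]
      congr 1
      rw [sub_eq_add_neg, Real.rpow_add hr, Real.rpow_natCast]; ring

lemma inner_t (n : ℕ) (hn : 2 ≤ n) {c : ℝ} (hc : 0 < c) :
    ∫⁻ t in Ioi c, ENNReal.ofReal ((t ^ n)⁻¹ * t⁻¹) = ENNReal.ofReal (c ^ (-(n:ℝ)) / n) := by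
  have hn0 : (0:ℝ) < n := by positivity
  have h1 : ∫⁻ t in Ioi c, ENNReal.ofReal ((t ^ n)⁻¹ * t⁻¹)
      = ∫⁻ t in Ioi c, ENNReal.ofReal (t ^ (-(n:ℝ) - 1)) := by
    refine setLIntegral_congr_fun measurableSet_Ioi fun t ht => ?_
    have ht0 : 0 < t := hc.trans ht
    rw [Real.rpow_sub ht0, Real.rpow_neg ht0.le, Real.rpow_natCast, Real.rpow_one, div_eq_mul_inv]
  rw [h1, ← ofReal_integral_eq_lintegral_ofReal
    (integrableOn_Ioi_rpow_of_lt (by linarith) hc), integral_Ioi_rpow_of_lt (by linarith) hc]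
  · congr 1
    rw [sub_add_cancel, neg_div_neg_eq]
  · filter_upwards [ae_restrict_mem measurableSet_Ioi] with t ht
    have ht0 : 0 < t := hc.trans ht
    simp only [Pi.zero_apply]; positivity

lemma radial (n : ℕ) (hn : 2 ≤ n) (x₀ x : EuclideanSpace ℝ (Fin n)) {R : ℝ} (hR : 0 < R)
    (hx : x ∈ Metric.ball x₀ R) (G : EuclideanSpace ℝ (Fin n) → ENNReal) (hG : Measurable G) :
    ∫⁻ y in Metric.ball x₀ R, ∫⁻ t in Ioc (0:ℝ) 1, G (x + t • (y - x)) * ENNReal.ofReal ‖y - x‖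
      ≤ ENNReal.ofReal ((2 * R) ^ n / n) *
        ∫⁻ z in Metric.ball x₀ R, ENNReal.ofReal (‖z - x‖ ^ (-((n:ℝ) - 1))) * G z := by
  have hn0 : (0:ℝ) < n := by positivity
  let H : ℝ → EuclideanSpace ℝ (Fin n) → ENNReal := fun t z =>
    ENNReal.ofReal ((t ^ n)⁻¹ * t⁻¹) * ((Metric.ball x₀ R).indicator
      (fun z => G z * ENNReal.ofReal ‖z - x‖) z * {p : ℝ × EuclideanSpace ℝ (Fin n) |
        ‖p.2 - x‖ < 2 * R * p.1}.indicator (fun _ => (1:ENNReal)) (t, z))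
  have hm1 : Measurable fun z => (Metric.ball x₀ R).indicator
      (fun z => G z * ENNReal.ofReal ‖z - x‖) z :=
    Measurable.indicator (by fun_prop) measurableSet_ball
  have hm2 : Measurable ({p : ℝ × EuclideanSpace ℝ (Fin n) |
        ‖p.2 - x‖ < 2 * R * p.1}.indicator (fun _ => (1:ENNReal))) :=
    Measurable.indicator measurable_const (measurableSet_lt (by fun_prop) (by fun_prop))
  have hHm : Measurable (fun p : ℝ × EuclideanSpace ℝ (Fin n) => H p.1 p.2) := by
    refine Measurable.mul (by fun_prop) (Measurable.mul (hm1.comp measurable_snd) hm2)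
  rw [lintegral_lintegral_swap (by fun_prop)]
  calc ∫⁻ t in Ioc (0:ℝ) 1, ∫⁻ y in Metric.ball x₀ R,
          G (x + t • (y - x)) * ENNReal.ofReal ‖y - x‖
      ≤ ∫⁻ t in Ioc (0:ℝ) 1, ∫⁻ z, H t z := by
        refine setLIntegral_mono' measurableSet_Ioc fun t ht => ?_
        have ht0 : 0 < t := ht.1
        let F : EuclideanSpace ℝ (Fin n) → ENNReal := fun z => ENNReal.ofReal t⁻¹ *
          ((Metric.ball x₀ R).indicator
      (fun z => G z * ENNReal.ofReal ‖z - x‖) z * {p : ℝ × EuclideanSpace ℝ (Fin n) |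
        ‖p.2 - x‖ < 2 * R * p.1}.indicator (fun _ => (1:ENNReal)) (t, z))
        have hFm : Measurable F := by
          refine Measurable.mul (by fun_prop) (Measurable.mul hm1 (hm2.comp (by fun_prop)))
        have h1 : ∫⁻ z, H t z = ∫⁻ y, F (x + t • (y - x)) := by
          rw [lintegral_cv x ht0 F hFm, ← lintegral_const_mul' _ _ ENNReal.ofReal_ne_top]
          refine lintegral_congr fun z => ?_
          simp only [H, F]
          rw [ENNReal.ofReal_mul (by positivity), mul_assoc]
        rw [h1, ← lintegral_indicator measurableSet_ball]
        refine lintegral_mono fun y => ?_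
        by_cases hy : y ∈ Metric.ball x₀ R
        · have hz : x + t • (y - x) ∈ Metric.ball x₀ R :=
            (convex_ball x₀ R).add_smul_sub_mem hx hy ⟨ht0.le, ht.2⟩
          have hyx : ‖y - x‖ < 2 * R := by
            rw [← dist_eq_norm]
            have := dist_triangle_right y x x₀
            rw [Metric.mem_ball] at hx hy
            linarith
          simp only [F]
          rw [indicator_of_mem hy, indicator_of_mem hz, indicator_of_mem, mul_one,
            add_sub_cancel_left, norm_smul, Real.norm_of_nonneg ht0.le,
            ENNReal.ofReal_mul ht0.le, mul_left_comm, ← mul_assoc (ENNReal.ofReal t⁻¹),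
            ← ENNReal.ofReal_mul (by positivity), inv_mul_cancel₀ ht0.ne', ENNReal.ofReal_one,
            one_mul]
          simp only [mem_ofPred_eq, add_sub_cancel_left, norm_smul, Real.norm_of_nonneg ht0.le]
          nlinarith
        · rw [indicator_of_notMem hy]; simp
    _ = ∫⁻ z, ∫⁻ t in Ioc (0:ℝ) 1, H t z := by
        rw [lintegral_lintegral_swap]
        exact hHm.aemeasurable
    _ ≤ ∫⁻ z, (Metric.ball x₀ R).indicator (fun z => ENNReal.ofReal ((2 * R) ^ n / n) *
          (ENNReal.ofReal (‖z - x‖ ^ (-((n:ℝ) - 1))) * G z)) z := by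
        refine lintegral_mono fun z => ?_
        by_cases hz : z ∈ Metric.ball x₀ R
        swap
        · simp [H, hz]
        rcases eq_or_ne z x with rfl | hzx
        · simp [H, indicator_of_mem hz]
        have hρ : 0 < ‖z - x‖ := norm_pos_iff.2 (sub_ne_zero.2 hzx)
        have hc : 0 < ‖z - x‖ / (2 * R) := by positivity
        simp only [H]
        rw [indicator_of_mem hz, indicator_of_mem hz]
        calc _ ≤ ∫⁻ t, (Ioi (‖z - x‖ / (2 * R))).indicator
                (fun t => ENNReal.ofReal ((t ^ n)⁻¹ * t⁻¹)) t
                  * (G z * ENNReal.ofReal ‖z - x‖) := by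
              refine (setLIntegral_le_lintegral _ _).trans (lintegral_mono fun t => ?_)
              by_cases hh : ‖z - x‖ < 2 * R * t
              · rw [indicator_of_mem (by exact hh), indicator_of_mem, mul_one]
                rw [mem_Ioi, div_lt_iff₀ (by positivity)]; linarith
              · rw [indicator_of_notMem (by exact hh)]; simp
          _ = ENNReal.ofReal ((‖z - x‖ / (2 * R)) ^ (-(n:ℝ)) / n)
                  * (G z * ENNReal.ofReal ‖z - x‖) := by
              rw [lintegral_mul_const, lintegral_indicator measurableSet_Ioi, inner_t n hn hc]
              exact Measurable.indicator (by fun_prop) measurableSet_Ioi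
          _ = _ := by
              rw [mul_comm (G z), ← mul_assoc, ← mul_assoc, ← ENNReal.ofReal_mul (by positivity),
                ← ENNReal.ofReal_mul (by positivity)]
              congr 2
              rw [neg_sub, Real.rpow_sub hρ, Real.rpow_one, Real.rpow_neg (by positivity),
                Real.rpow_natCast, Real.rpow_natCast, div_pow]
              field_simp
    _ = _ := by
        rw [lintegral_indicator measurableSet_ball, lintegral_const_mul' _ _ ENNReal.ofReal_ne_top]

lemma ftc {n : ℕ} {K : NNReal} {v : EuclideanSpace ℝ (Fin n) → ℝ} (hv : LipschitzWith K v)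
    (x y : EuclideanSpace ℝ (Fin n))
    (hd : ∀ᵐ t ∂(volume.restrict (Ioc (0:ℝ) 1)), DifferentiableAt ℝ v (x + t • (y - x))) :
    ‖v x - v y‖ₑ ≤ ∫⁻ t in Ioc (0:ℝ) 1,
      ENNReal.ofReal ‖gradient v (x + t • (y - x))‖ * ENNReal.ofReal ‖y - x‖ := by
  let f : ℝ → ℝ := fun t => v (x + t • (y - x))
  have hf : LipschitzWith (K * ‖y - x‖₊) f := by
    refine hv.comp (LipschitzWith.of_dist_le_mul fun a b => ?_)
    rw [dist_add_left, dist_eq_norm, ← sub_smul, norm_smul, dist_eq_norm, mul_comm]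
    rfl
  have h1 := (hf.lipschitzOnWith (s := uIcc 0 1)).absolutelyContinuousOnInterval.integral_deriv_eq_sub
  have h2 : f 1 - f 0 = v y - v x := by simp [f]
  rw [h2, intervalIntegral.integral_of_le zero_le_one] at h1
  have h3 : ‖v x - v y‖ₑ = ‖v y - v x‖ₑ := enorm_sub_rev _ _
  rw [h3, ← h1]
  refine (enorm_integral_le_lintegral_enorm _).trans (lintegral_mono_ae ?_)
  filter_upwards [hd] with t ht
  have h4 : HasDerivAt f (fderiv ℝ v (x + t • (y - x)) (y - x)) t := by
    have h5 : HasDerivAt (fun t : ℝ => x + t • (y - x)) (y - x) t := by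
      simpa using ((hasDerivAt_id t).smul_const (y - x)).const_add x
    exact ht.hasFDerivAt.comp_hasDerivAt t h5
  rw [h4.deriv, ← ENNReal.ofReal_mul (norm_nonneg _), ← ofReal_norm]
  apply ENNReal.ofReal_le_ofReal
  refine (ContinuousLinearMap.le_opNorm _ _).trans (le_of_eq ?_)
  congr 1
  simp [gradient]

lemma meas_grad {n : ℕ} (v : EuclideanSpace ℝ (Fin n) → ℝ) :
    Measurable fun z => ‖gradient v z‖ := by
  have : (fun z => ‖gradient v z‖) = fun z => ‖fderiv ℝ v z‖ := by
    funext z; simp [gradient]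
  rw [this]
  exact (measurable_fderiv ℝ v).norm

lemma ae_line {n : ℕ} {K : NNReal} {v : EuclideanSpace ℝ (Fin n) → ℝ} (hv : LipschitzWith K v)
    (x : EuclideanSpace ℝ (Fin n)) :
    ∀ᵐ y, ∀ᵐ t ∂(volume.restrict (Ioc (0:ℝ) 1)), DifferentiableAt ℝ v (x + t • (y - x)) := by
  have hD : MeasurableSet {z | DifferentiableAt ℝ v z} := measurableSet_of_differentiableAt ℝ v
  let N : EuclideanSpace ℝ (Fin n) → ENNReal := {z | DifferentiableAt ℝ v z}ᶜ.indicator 1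
  have hN : Measurable N := measurable_one.indicator hD.compl
  have hN0 : ∫⁻ z, N z = 0 := by
    rw [lintegral_indicator_one hD.compl]
    exact hv.ae_differentiableAt (μ := volume)
  have h1 : ∫⁻ y, ∫⁻ t in Ioc (0:ℝ) 1, N (x + t • (y - x)) = 0 := by
    rw [lintegral_lintegral_swap (by fun_prop)]
    rw [setLIntegral_congr_fun (g := fun _ => 0) measurableSet_Ioc]
    · simp
    · intro t ht
      simp only
      rw [lintegral_cv x ht.1 N hN, hN0, mul_zero]
  rw [lintegral_eq_zero_iff (by fun_prop)] at h1
  filter_upwards [h1] with y hy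
  simp only [Pi.zero_apply] at hy
  rw [lintegral_eq_zero_iff (by fun_prop)] at hy
  filter_upwards [hy] with t ht
  by_contra hcon
  simp [N, hcon] at ht

lemma pointwise (n : ℕ) (hn : 2 ≤ n) (x₀ x : EuclideanSpace ℝ (Fin n)) {R : ℝ} (hR : 0 < R)
    (hx : x ∈ Metric.ball x₀ R) {K : NNReal} {v : EuclideanSpace ℝ (Fin n) → ℝ}
    (hv : LipschitzWith K v) :
    ENNReal.ofReal (|v x - ⨍ y in Metric.ball x₀ R, v y| * volume.real (Metric.ball x₀ R))
      ≤ ENNReal.ofReal ((2 * R) ^ n / n) *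
        ∫⁻ z in Metric.ball x₀ R, ENNReal.ofReal (‖z - x‖ ^ (-((n:ℝ) - 1))) *
          ENNReal.ofReal ‖gradient v z‖ := by
  have hpos : 0 < volume.real (Metric.ball x₀ R) :=
    ENNReal.toReal_pos (Metric.measure_ball_pos volume x₀ hR).ne' measure_ball_lt_top.ne
  have hvi : IntegrableOn v (Metric.ball x₀ R) :=
    (hv.continuous.continuousOn.integrableOn_compact (isCompact_closedBall x₀ R)).mono_set
      Metric.ball_subset_closedBall
  have hci : IntegrableOn (fun _ : EuclideanSpace ℝ (Fin n) => v x) (Metric.ball x₀ R) :=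
    integrableOn_const measure_ball_lt_top.ne
  have h0 : (v x - ⨍ y in Metric.ball x₀ R, v y) * volume.real (Metric.ball x₀ R)
      = ∫ y in Metric.ball x₀ R, (v x - v y) := by
    rw [integral_sub hci hvi, setIntegral_const, setAverage_eq, smul_eq_mul,
      smul_eq_mul]
    field_simp
  have h1 : ENNReal.ofReal (|v x - ⨍ y in Metric.ball x₀ R, v y| *
      volume.real (Metric.ball x₀ R)) = ‖∫ y in Metric.ball x₀ R, (v x - v y)‖ₑ := by
    rw [← h0, ← ofReal_norm, norm_mul, Real.norm_eq_abs, Real.norm_of_nonneg hpos.le]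
  rw [h1]
  refine (enorm_integral_le_lintegral_enorm _).trans ?_
  refine le_trans ?_ (radial n hn x₀ x hR hx (fun z => ENNReal.ofReal ‖gradient v z‖)
    (meas_grad v).ennreal_ofReal)
  refine lintegral_mono_ae (ae_restrict_of_ae ?_)
  filter_upwards [ae_line hv x] with y hy
  exact ftc hv x y hy


lemma riesz_pt {α : Type*} [MeasurableSpace α] (μ : Measure α) {p : ℝ} (hp : 1 < p)
    (k g : α → ENNReal) (hk : Measurable k) (hg : Measurable g) :
    (∫⁻ z, k z * g z ∂μ) ^ p ≤ (∫⁻ z, k z ^ p * g z ∂μ) * (∫⁻ z, g z ∂μ) ^ (p - 1) := by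
  have hpq := Real.HolderConjugate.conjExponent hp
  set q := p.conjExponent
  have hp0 : 0 < p := by linarith
  have hq0 : 0 < q := hpq.symm.pos
  have h1 := ENNReal.lintegral_mul_le_Lp_mul_Lq μ hpq (f := fun z => k z * g z ^ (1 / p))
    (g := fun z => g z ^ (1 / q)) (by fun_prop) (by fun_prop)
  have e1 : ∀ z, ((fun z => k z * g z ^ (1 / p)) * fun z => g z ^ (1 / q)) z = k z * g z := by
    intro z
    simp only [Pi.mul_apply]
    rw [mul_assoc, ← ENNReal.rpow_add_of_nonneg _ _ (by positivity) (by positivity)]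
    have : 1 / p + 1 / q = 1 := by
      have := hpq.inv_add_inv_eq_one
      simpa [one_div] using this
    rw [this, ENNReal.rpow_one]
  have e2 : ∀ z, (k z * g z ^ (1 / p)) ^ p = k z ^ p * g z := by
    intro z
    rw [ENNReal.mul_rpow_of_nonneg _ _ hp0.le, ← ENNReal.rpow_mul, one_div,
      inv_mul_cancel₀ hp0.ne', ENNReal.rpow_one]
  have e3 : ∀ z, (g z ^ (1 / q)) ^ q = g z := by
    intro z
    rw [← ENNReal.rpow_mul, one_div, inv_mul_cancel₀ hq0.ne', ENNReal.rpow_one]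
  simp only [e1, e2, e3] at h1
  calc (∫⁻ z, k z * g z ∂μ) ^ p ≤ _ := ENNReal.rpow_le_rpow h1 hp0.le
    _ = _ := by
      rw [ENNReal.mul_rpow_of_nonneg _ _ hp0.le, ← ENNReal.rpow_mul, ← ENNReal.rpow_mul, one_div,
        inv_mul_cancel₀ hp0.ne', ENNReal.rpow_one]
      congr 2
      have := hpq.div_conj_eq_sub_one
      rw [← this]; ring

lemma riesz (n : ℕ) (p : ℝ) (hp : 1 < p) (C : ℝ)
    (hC : ∀ (y : EuclideanSpace ℝ (Fin n)) (r : ℝ), 0 < r →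
      ∫⁻ x in Metric.ball y r, ENNReal.ofReal (‖x - y‖ ^ (-(((n:ℝ) - 1) * p))) ≤
        ENNReal.ofReal (C * r ^ ((n:ℝ) - ((n:ℝ) - 1) * p)))
    (x₀ : EuclideanSpace ℝ (Fin n)) {R : ℝ} (hR : 0 < R)
    (g : EuclideanSpace ℝ (Fin n) → ENNReal) (hg : Measurable g) :
    ∫⁻ x in Metric.ball x₀ R, (∫⁻ z in Metric.ball x₀ R,
        ENNReal.ofReal (‖z - x‖ ^ (-((n:ℝ) - 1))) * g z) ^ p
      ≤ ENNReal.ofReal (C * (2 * R) ^ ((n:ℝ) - ((n:ℝ) - 1) * p)) *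
        (∫⁻ z in Metric.ball x₀ R, g z) ^ p := by
  have hp0 : 0 < p := by linarith
  have hkm : Measurable fun q : EuclideanSpace ℝ (Fin n) × EuclideanSpace ℝ (Fin n) =>
      ENNReal.ofReal (‖q.2 - q.1‖ ^ (-((n:ℝ) - 1))) ^ p * g q.2 := by
    fun_prop
  calc _ ≤ ∫⁻ x in Metric.ball x₀ R, (∫⁻ z in Metric.ball x₀ R,
        ENNReal.ofReal (‖z - x‖ ^ (-((n:ℝ) - 1))) ^ p * g z) *
          (∫⁻ z in Metric.ball x₀ R, g z) ^ (p - 1) := by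
        refine lintegral_mono fun x => ?_
        exact riesz_pt _ hp _ g (by fun_prop) hg
    _ = (∫⁻ x in Metric.ball x₀ R, ∫⁻ z in Metric.ball x₀ R,
        ENNReal.ofReal (‖z - x‖ ^ (-((n:ℝ) - 1))) ^ p * g z) *
          (∫⁻ z in Metric.ball x₀ R, g z) ^ (p - 1) := by
        rw [lintegral_mul_const]
        exact hkm.lintegral_prod_right'
    _ = (∫⁻ z in Metric.ball x₀ R, ∫⁻ x in Metric.ball x₀ R,
        ENNReal.ofReal (‖z - x‖ ^ (-((n:ℝ) - 1))) ^ p * g z) *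
          (∫⁻ z in Metric.ball x₀ R, g z) ^ (p - 1) := by
        rw [lintegral_lintegral_swap]
        exact hkm.aemeasurable
    _ ≤ (∫⁻ z in Metric.ball x₀ R, ENNReal.ofReal (C * (2 * R) ^ ((n:ℝ) - ((n:ℝ) - 1) * p)) *
          g z) * (∫⁻ z in Metric.ball x₀ R, g z) ^ (p - 1) := by
        gcongr ?_ * _
        refine setLIntegral_mono' measurableSet_ball fun z hz => ?_
        rw [lintegral_mul_const _ (by fun_prop)]
        gcongr
        refine le_trans ?_ (hC z (2 * R) (by positivity))
        have hsub : Metric.ball x₀ R ⊆ Metric.ball z (2 * R) := by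
          intro x hx
          rw [Metric.mem_ball] at *
          have := dist_triangle_right x z x₀
          linarith
        refine (lintegral_mono_set hsub).trans (lintegral_mono fun x => le_of_eq ?_)
        rw [ENNReal.ofReal_rpow_of_nonneg (by positivity) hp0.le, ← Real.rpow_mul (norm_nonneg _),
          norm_sub_rev, neg_mul]
    _ = _ := by
        rw [lintegral_const_mul' _ _ ENNReal.ofReal_ne_top, mul_assoc]
        congr 1
        nth_rewrite 1 [← ENNReal.rpow_one (∫⁻ z in Metric.ball x₀ R, g z)]
        rw [← ENNReal.rpow_add_of_nonneg _ _ zero_le_one (by linarith)]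
        congr 1; ring

lemma NF.meas {Φ : ℝ → ℝ} {s : ℝ} (h : IsNFunction Φ s) {α : Type*} [MeasurableSpace α]
    {f : α → ℝ} (hf : Measurable f) (hf0 : ∀ x, 0 ≤ f x) : Measurable fun x => Φ (f x) := by
  have h1 : Monotone fun t => Φ (max t 0) := by
    intro a b hab
    exact h.strictMonoOn.monotoneOn (by simp) (by simp) (max_le_max_right 0 hab)
  have h2 := h1.measurable.comp hf
  have : (fun x => Φ (f x)) = (fun t => Φ (max t 0)) ∘ f := by
    funext x; simp [max_eq_left (hf0 x)]
  rw [this]; exact h2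

lemma potential (n : ℕ) (hn : 2 ≤ n) (C₁ : ℝ) (hC₁ : 0 < C₁)
    (hC : ∀ (y : EuclideanSpace ℝ (Fin n)) (r : ℝ), 0 < r →
      ∫⁻ x in Metric.ball y r, ENNReal.ofReal (‖x - y‖ ^ (-((n:ℝ) - 1))) ≤
        ENNReal.ofReal (C₁ * r ^ ((n:ℝ) - ((n:ℝ) - 1))))
    {Φ : ℝ → ℝ} {s θ : ℝ} (h : IsNFunction Φ s) (hθ : s / (s + 1) ≤ θ) (hθ1 : θ < 1)
    {ω : ℝ} (hω : 0 < ω)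
    {l : ℝ} (hl1 : 1 ≤ l) (hl : 2 ^ n / (n * ω) * 4 * C₁ ≤ l)
    (x₀ x : EuclideanSpace ℝ (Fin n)) {R : ℝ} (hR : 0 < R)
    (hvol : volume.real (Metric.ball x₀ R) = ω * R ^ n)
    (hx : x ∈ Metric.ball x₀ R) {K : NNReal} {v : EuclideanSpace ℝ (Fin n) → ℝ}
    (hv : LipschitzWith K v) :
    ENNReal.ofReal (Φ (|v x - ⨍ y in Metric.ball x₀ R, v y| / R) ^ θ) ≤
      ENNReal.ofReal (l ^ (1 + s) / (2 * C₁ * R)) *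
        ∫⁻ z in Metric.ball x₀ R, ENNReal.ofReal (‖z - x‖ ^ (-((n:ℝ) - 1))) *
          ENNReal.ofReal (Φ ‖gradient v z‖ ^ θ) := by
  have hn0 : (0:ℝ) < n := by positivity
  have hs := h.s_ge_one
  have hθ0 : 0 < θ := lt_of_lt_of_le (by positivity) hθ
  have hpt := pointwise n hn x₀ x hR hx hv
  set u := |v x - ⨍ y in Metric.ball x₀ R, v y| with hu
  have hu0 : 0 ≤ u := abs_nonneg _
  let k : EuclideanSpace ℝ (Fin n) → ENNReal := fun z =>
    ENNReal.ofReal (‖z - x‖ ^ (-((n:ℝ) - 1)))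
  have hk : Measurable k := by fun_prop
  let ν := (volume.restrict (Metric.ball x₀ R)).withDensity k
  have hM : 0 < 2 * C₁ * R := by positivity
  have hν : ν univ ≤ ENNReal.ofReal (2 * C₁ * R) := by
    simp only [ν]
    rw [withDensity_apply _ MeasurableSet.univ, Measure.restrict_univ]
    have hsub : Metric.ball x₀ R ⊆ Metric.ball x (2 * R) := by
      intro y hy
      rw [Metric.mem_ball] at *
      have := dist_triangle_right y x x₀
      linarith
    refine (lintegral_mono_set hsub).trans ((hC x (2 * R) (by positivity)).trans ?_)
    apply ENNReal.ofReal_le_ofReal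
    rw [sub_sub_cancel, Real.rpow_one]
    linarith
  set A : ℝ := 2 ^ n / (n * ω) with hA
  have hA0 : 0 < A := by positivity
  have hν2 : ∀ f : EuclideanSpace ℝ (Fin n) → ENNReal, Measurable f →
      ∫⁻ z, f z ∂ν = ∫⁻ z in Metric.ball x₀ R, k z * f z := fun f hf => by
    simp only [ν]
    rw [lintegral_withDensity_eq_lintegral_mul _ hk hf]; rfl
  have hgm := meas_grad v
  have hm : ENNReal.ofReal (u / A) ≤ ∫⁻ z, ENNReal.ofReal ‖gradient v z‖ ∂ν := by
    rw [hν2 _ hgm.ennreal_ofReal]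
    have hc : 0 < (2 * R) ^ n / n := by positivity
    have e : u / A = ((2 * R) ^ n / n)⁻¹ * (u * volume.real (Metric.ball x₀ R)) := by
      rw [hvol, hA, mul_pow]; field_simp
    rw [e, ENNReal.ofReal_mul (by positivity)]
    calc _ ≤ ENNReal.ofReal ((2 * R) ^ n / n)⁻¹ * (ENNReal.ofReal ((2 * R) ^ n / n) * _) :=
          mul_le_mul_right hpt _
      _ = _ := by
        rw [← mul_assoc, ← ENNReal.ofReal_mul (by positivity), inv_mul_cancel₀ hc.ne',
          ENNReal.ofReal_one, one_mul]
  have hJ := NF.jensen h hθ ν hM hν (fun z => ‖gradient v z‖) (fun z => norm_nonneg _)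
    (m := u / A) (by positivity) hm
  rw [hν2 _ ((NF.meas h hgm fun z => norm_nonneg _).pow_const θ).ennreal_ofReal] at hJ
  set a := u / A / (2 * (2 * C₁ * R)) with ha
  have ha0 : 0 ≤ a := by positivity
  have h1 : u / R ≤ l * a := by
    calc u / R = (A * 4 * C₁) * a := by rw [ha]; field_simp; ring
      _ ≤ _ := by gcongr
  have h2 : Φ (u / R) ^ θ ≤ l ^ (1 + s) * Φ a ^ θ := by
    refine le_trans ?_ (NF.psi_double h hθ0 hθ1 hl1 ha0)
    have h3 : 0 ≤ u / R := by positivity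
    refine Real.rpow_le_rpow (h.nonneg _ h3) ?_ hθ0.le
    exact h.strictMonoOn.monotoneOn h3 (h3.trans h1) h1
  calc ENNReal.ofReal (Φ (u / R) ^ θ) ≤ ENNReal.ofReal (l ^ (1 + s) * Φ a ^ θ) :=
        ENNReal.ofReal_le_ofReal h2
    _ = ENNReal.ofReal (l ^ (1 + s) / (2 * C₁ * R)) *
          ENNReal.ofReal (2 * C₁ * R * Φ a ^ θ) := by
        rw [← ENNReal.ofReal_mul (by positivity)]
        congr 1; field_simp
    _ ≤ _ := by gcongr

end OSP

/-- Orlicz Sobolev–Poincaré inequality: for `n ≥ 2`, `s ≥ 1` and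
`d₀ ∈ [1, n/(n−1))` there are `θ ∈ (0,1)` and `c > 0`, depending only on `n, s, d₀`, such
that for every N-function `Φ` with index `s`, every ball `B_R(x₀) ⊂ ℝⁿ` and every Lipschitz
`v : ℝⁿ → ℝ`,
`(⨍_{B_R} Φ(|v − (v)_{B_R}|/R)^{d₀})^{1/d₀} ≤ c·(⨍_{B_R} Φ(|Dv|)^θ)^{1/θ}`. -/
theorem statement18 (n : ℕ) (hn : 2 ≤ n) (s : ℝ) (hs : 1 ≤ s)
    (d₀ : ℝ) (hd₀ : 1 ≤ d₀) (hd₀' : d₀ < (n : ℝ) / ((n : ℝ) - 1)) :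
    ∃ θ : ℝ, 0 < θ ∧ θ < 1 ∧ ∃ c : ℝ, 0 < c ∧
      ∀ Φ : ℝ → ℝ, IsNFunction Φ s →
      ∀ (x₀ : EuclideanSpace ℝ (Fin n)) (R : ℝ), 0 < R →
      ∀ v : EuclideanSpace ℝ (Fin n) → ℝ, (∃ K : NNReal, LipschitzWith K v) →
        (⨍ x in Metric.ball x₀ R,
            (Φ (|v x - (⨍ y in Metric.ball x₀ R, v y)| / R)) ^ d₀) ^ (1 / d₀)
          ≤ c * (⨍ x in Metric.ball x₀ R, (Φ ‖gradient v x‖) ^ θ) ^ (1 / θ) := by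
  have hn0 : (0:ℝ) < n := by positivity
  have hn1 : (0:ℝ) < (n:ℝ) - 1 := by
    have : (2:ℝ) ≤ n := by exact_mod_cast hn
    linarith
  rw [lt_div_iff₀ hn1] at hd₀'
  have hr1 : d₀ * ((n:ℝ) - 1) / n < 1 := by rw [div_lt_one hn0]; exact hd₀'
  have hs1 : s / (s + 1) < 1 := by rw [div_lt_one (by linarith)]; linarith
  obtain ⟨θ, hθ, hθ1⟩ := exists_between (max_lt hr1 hs1)
  have hθa : d₀ * ((n:ℝ) - 1) / n < θ := (le_max_left _ _).trans_lt hθ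
  have hθs : s / (s + 1) ≤ θ := ((le_max_right _ _).trans_lt hθ).le
  have hθ0 : 0 < θ := lt_of_lt_of_le (by positivity) hθs
  have hd0 : 0 < d₀ := by linarith
  set p := d₀ / θ with hp
  have hp1 : 1 < p := by rw [hp, one_lt_div hθ0]; linarith
  have hp0 : 0 < p := by linarith
  have hpn : ((n:ℝ) - 1) * p < n := by
    rw [div_lt_iff₀ hn0] at hθa
    rw [hp, ← mul_div_assoc, div_lt_iff₀ hθ0]; linarith
  obtain ⟨C₁, hC₁, hK₁⟩ := OSP.kernel_bound n hn ((n:ℝ) - 1) (by linarith)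
  obtain ⟨C₂, hC₂, hK₂⟩ := OSP.kernel_bound n hn (((n:ℝ) - 1) * p) hpn
  set ω := volume.real (Metric.ball (0 : EuclideanSpace ℝ (Fin n)) 1) with hωdef
  have hω : 0 < ω :=
    ENNReal.toReal_pos (Metric.measure_ball_pos volume _ one_pos).ne' measure_ball_lt_top.ne
  set l := max 1 (2 ^ n / (n * ω) * 4 * C₁) with hldef
  have hl1 : 1 ≤ l := le_max_left _ _
  have hl0 : 0 < l := by linarith
  set e := (n:ℝ) - ((n:ℝ) - 1) * p with he
  set D := (l ^ (1 + s) / (2 * C₁)) ^ p * (C₂ * 2 ^ e) * ω ^ p / ω with hD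
  have hD0 : 0 < D := by positivity
  refine ⟨θ, hθ0, hθ1, D ^ (1 / d₀), by positivity, ?_⟩
  intro Φ h x₀ R hR v ⟨K, hv⟩
  have hvol : volume.real (Metric.ball x₀ R) = ω * R ^ n := by
    rw [hωdef, measureReal_def, measureReal_def, Measure.addHaar_ball_of_pos volume x₀ hR,
      ENNReal.toReal_mul, ENNReal.toReal_ofReal (by positivity)]
    simp [mul_comm]
  set B := Metric.ball x₀ R with hB
  set m := ⨍ y in B, v y with hm
  have hgm : Measurable fun z => Φ ‖gradient v z‖ ^ θ :=
    (OSP.NF.meas h (OSP.meas_grad v) fun z => norm_nonneg _).pow_const θ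
  have hg0 : ∀ z, 0 ≤ Φ ‖gradient v z‖ ^ θ := fun z =>
    Real.rpow_nonneg (h.nonneg _ (norm_nonneg _)) _
  have hgi : IntegrableOn (fun z => Φ ‖gradient v z‖ ^ θ) B := by
    refine Measure.integrableOn_of_bounded (M := Φ K ^ θ) measure_ball_lt_top.ne
      hgm.aestronglyMeasurable ?_
    refine Eventually.of_forall fun z => ?_
    rw [Real.norm_of_nonneg (hg0 z)]
    have h1 : ‖gradient v z‖ ≤ K := by
      have := norm_fderiv_le_of_lipschitz ℝ hv (x₀ := z)
      simpa [gradient] using this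
    exact Real.rpow_le_rpow (h.nonneg _ (norm_nonneg _))
      (h.strictMonoOn.monotoneOn (norm_nonneg _) K.2 h1) hθ0.le
  have hG : ∫⁻ z in B, ENNReal.ofReal (Φ ‖gradient v z‖ ^ θ)
      = ENNReal.ofReal (∫ z in B, Φ ‖gradient v z‖ ^ θ) :=
    (ofReal_integral_eq_lintegral_ofReal hgi (Eventually.of_forall hg0)).symm
  set I := ∫ z in B, Φ ‖gradient v z‖ ^ θ with hI
  have hI0 : 0 ≤ I := integral_nonneg hg0
  have hu0 : ∀ x, 0 ≤ |v x - m| / R := fun x => by positivity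
  have hfm : Measurable fun x => Φ (|v x - m| / R) ^ d₀ := by
    refine (OSP.NF.meas h ?_ hu0).pow_const d₀
    have : Continuous fun x => |v x - m| / R :=
      ((hv.continuous.sub continuous_const).abs).div_const R
    exact this.measurable
  have hf0 : ∀ x, 0 ≤ Φ (|v x - m| / R) ^ d₀ := fun x =>
    Real.rpow_nonneg (h.nonneg _ (hu0 x)) _
  have key : ∫⁻ x in B, ENNReal.ofReal (Φ (|v x - m| / R) ^ d₀) ≤
      ENNReal.ofReal ((l ^ (1 + s) / (2 * C₁ * R)) ^ p * (C₂ * (2 * R) ^ e * I ^ p)) := by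
    calc _ ≤ ∫⁻ x in B, ENNReal.ofReal ((l ^ (1 + s) / (2 * C₁ * R)) ^ p) *
          (∫⁻ z in B, ENNReal.ofReal (‖z - x‖ ^ (-((n:ℝ) - 1))) *
            ENNReal.ofReal (Φ ‖gradient v z‖ ^ θ)) ^ p := by
          refine setLIntegral_mono' measurableSet_ball fun x hx => ?_
          have h1 := OSP.potential n hn C₁ hC₁ hK₁ h hθs hθ1 hω hl1 (le_max_right _ _) x₀ x hR
            hvol hx hv
          have h2 : Φ (|v x - m| / R) ^ d₀ = (Φ (|v x - m| / R) ^ θ) ^ p := by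
            rw [← Real.rpow_mul (h.nonneg _ (hu0 x)), hp]
            congr 1; field_simp
          rw [h2, ← ENNReal.ofReal_rpow_of_nonneg (Real.rpow_nonneg (h.nonneg _ (hu0 x)) _) hp0.le,
            ← ENNReal.ofReal_rpow_of_nonneg (by positivity) hp0.le,
            ← ENNReal.mul_rpow_of_nonneg _ _ hp0.le]
          exact ENNReal.rpow_le_rpow h1 hp0.le
      _ ≤ ENNReal.ofReal ((l ^ (1 + s) / (2 * C₁ * R)) ^ p) *
          (ENNReal.ofReal (C₂ * (2 * R) ^ e) * ENNReal.ofReal I ^ p) := by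
          rw [lintegral_const_mul' _ _ ENNReal.ofReal_ne_top, ← hG]
          gcongr
          exact OSP.riesz n p hp1 C₂ hK₂ x₀ hR _ hgm.ennreal_ofReal
      _ = _ := by
          rw [ENNReal.ofReal_rpow_of_nonneg hI0 hp0.le, ← ENNReal.ofReal_mul (by positivity),
            ← ENNReal.ofReal_mul (by positivity)]
  have key2 : ∫ x in B, Φ (|v x - m| / R) ^ d₀ ≤
      (l ^ (1 + s) / (2 * C₁ * R)) ^ p * (C₂ * (2 * R) ^ e * I ^ p) := by
    rw [integral_eq_lintegral_of_nonneg_ae (Eventually.of_forall hf0)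
      hfm.aestronglyMeasurable]
    exact ENNReal.toReal_le_of_le_ofReal (by positivity) key
  have hY : ⨍ x in B, Φ ‖gradient v x‖ ^ θ = I / (ω * R ^ n) := by
    rw [setAverage_eq, hvol, smul_eq_mul, ← hI]; ring
  have hX : ⨍ x in B, Φ (|v x - m| / R) ^ d₀ ≤ D * (I / (ω * R ^ n)) ^ p := by
    rw [setAverage_eq, hvol, smul_eq_mul]
    have hω' : 0 < ω * R ^ n := by positivity
    rw [inv_mul_le_iff₀ hω']
    refine key2.trans (le_of_eq ?_)
    have e1 : (l ^ (1 + s) / (2 * C₁ * R)) ^ p = (l ^ (1 + s) / (2 * C₁)) ^ p / R ^ p := by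
      rw [← div_div, Real.div_rpow (by positivity) hR.le]
    have e2 : (2 * R) ^ e = 2 ^ e * (R ^ n * R ^ p / (R ^ n) ^ p) := by
      rw [Real.mul_rpow (by norm_num) hR.le]
      congr 1
      rw [← Real.rpow_natCast R n, ← Real.rpow_mul hR.le, ← Real.rpow_add hR, ← Real.rpow_sub hR,
        he]
      congr 1; ring
    have e3 : (I / (ω * R ^ n)) ^ p = I ^ p / (ω ^ p * (R ^ n) ^ p) := by
      rw [Real.div_rpow hI0 hω'.le, Real.mul_rpow hω.le (by positivity)]
    rw [e1, e2, e3, hD]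
    have : 0 < ω ^ p := by positivity
    have : 0 < R ^ p := by positivity
    have : 0 < (R ^ n) ^ p := by positivity
    field_simp
  rw [hY]
  have hY0 : 0 ≤ I / (ω * R ^ n) := by positivity
  calc _ ≤ (D * (I / (ω * R ^ n)) ^ p) ^ (1 / d₀) := by
        refine Real.rpow_le_rpow ?_ hX (by positivity)
        rw [setAverage_eq, smul_eq_mul]
        exact mul_nonneg (by positivity) (integral_nonneg hf0)
    _ = _ := by
        rw [Real.mul_rpow hD0.le (by positivity), ← Real.rpow_mul hY0, hp]
        congr 2; field_simp
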